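/- Let P, Q ⊂ ℝ^n be rational polytopes such that P ⊕ Q is a free sum. Then the multivariate Braun equation σ_{cone(P⊕Q)}(z) = (1 − z_{n+1})·σ_{cone P}(z)·σ_{cone Q}(z) holds — i.e., for every m ∈ ℤ^{n+1}, N_{P,Q}(m) − N_{P,Q}(m − e_{n+1}) equals 1 if m ∈ cone(P ⊕ Q) and 0 otherwise — if and only if P^∨ is a lattice polyhedron or Q^∨ is a lattice polyhedron. -/

import Mathlib

open Set Pointwise
open scoped Classical

noncomputable section

namespace ArxivFreeSum

/-- A point of `ℝ^m` is an integer lattice point iff all coordinates are integers. -/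
def IsLat {m : ℕ} (x : Fin m → ℝ) : Prop := ∀ i, ∃ z : ℤ, x i = (z : ℝ)

/-- The set of integer lattice points of a set `S`. -/
def latt {m : ℕ} (S : Set (Fin m → ℝ)) : Set (Fin m → ℝ) := {x | x ∈ S ∧ IsLat x}

variable {n : ℕ}

/-- The affine embedding `α : ℝ^n → ℝ^{n+1}`, `a ↦ (a, 1)`. -/
def emb (a : Fin n → ℝ) : Fin (n + 1) → ℝ := Fin.snoc a 1

/-- The cone over `K`: all nonnegative multiples of `α(K)`. -/
def cone (K : Set (Fin n → ℝ)) : Set (Fin (n + 1) → ℝ) :=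
  {x | ∃ l : ℝ, ∃ a ∈ K, 0 ≤ l ∧ x = l • emb a}

/-- The last standard basis vector `e_{n+1}` of `ℝ^{n+1}`. -/
def eLast (n : ℕ) : Fin (n + 1) → ℝ := Pi.single (Fin.last n) 1

/-- The vertical projection `ε_J` onto the lower envelope of `cone J`. -/
def eps (J : Set (Fin n → ℝ)) (x : Fin (n + 1) → ℝ) : Fin (n + 1) → ℝ :=
  x - sSup {l : ℝ | x - l • eLast n ∈ cone J} • eLast n

/-- The lower envelope of `cone J`. -/
def lenv (J : Set (Fin n → ℝ)) : Set (Fin (n + 1) → ℝ) := eps J '' cone J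

/-- The lower lattice envelope of `cone J`. -/
def llenv (J : Set (Fin n → ℝ)) : Set (Fin (n + 1) → ℝ) := eps J '' latt (cone J)

/-- `J ⊕ K` is a free sum. -/
def IsFreeSum (J K : Set (Fin n → ℝ)) : Prop :=
  (0 : Fin n → ℝ) ∈ J ∧ (0 : Fin n → ℝ) ∈ K ∧
    ∀ m : Fin n → ℝ, m ∈ Submodule.span ℝ (J ∪ K) → IsLat m →
      ∃! q : (Fin n → ℝ) × (Fin n → ℝ),
        (q.1 ∈ Submodule.span ℝ J ∧ IsLat q.1) ∧
        (q.2 ∈ Submodule.span ℝ K ∧ IsLat q.2) ∧ m = q.1 + q.2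

/-- `N_{J,K}(m)`: the number of pairs of lattice points of `cone J` and `cone K` summing
to `m`. -/
def Npairs (J K : Set (Fin n → ℝ)) (m : Fin (n + 1) → ℤ) : ℕ :=
  Set.ncard {q : (Fin (n + 1) → ℝ) × (Fin (n + 1) → ℝ) |
    q.1 ∈ latt (cone J) ∧ q.2 ∈ latt (cone K) ∧ q.1 + q.2 = fun i => (m i : ℝ)}

/-- The coefficientwise form of the multivariate Braun equation
`σ_{cone(J⊕K)} = (1 - z_{n+1}) σ_{cone J} σ_{cone K}`. -/
def BraunEq (J K : Set (Fin n → ℝ)) : Prop :=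
  ∀ m : Fin (n + 1) → ℤ,
    (Npairs J K m : ℤ) - (Npairs J K (m - Pi.single (Fin.last n) 1) : ℤ) =
      if (fun i => (m i : ℝ)) ∈ cone (convexHull ℝ (J ∪ K)) then 1 else 0

/-- A rational polytope: convex hull of finitely many rational points. -/
def IsRatPolytope (P : Set (Fin n → ℝ)) : Prop :=
  ∃ V : Finset (Fin n → ℝ), (∀ v ∈ V, ∀ i, ∃ q : ℚ, v i = (q : ℝ)) ∧
    P = convexHull ℝ (V : Set (Fin n → ℝ))

/-- A lattice polytope: convex hull of finitely many lattice points. -/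
def IsLatPolytope (P : Set (Fin n → ℝ)) : Prop :=
  ∃ V : Finset (Fin n → ℝ), (∀ v ∈ V, IsLat v) ∧ P = convexHull ℝ (V : Set (Fin n → ℝ))

/-- The polar dual `P^∨ ⊆ (lin P)^*` of a polytope `P` containing the origin. -/
def dualSet (P : Set (Fin n → ℝ)) : Set (Module.Dual ℝ (Submodule.span ℝ P)) :=
  {φ | ∀ a : Submodule.span ℝ P, (a : Fin n → ℝ) ∈ P → φ a ≤ 1}

/-- Membership in the dual integer lattice `(lin P)^*_ℤ`. -/
def IsDualLatticePt (P : Set (Fin n → ℝ)) (φ : Module.Dual ℝ (Submodule.span ℝ P)) : Prop :=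
  ∀ a : Submodule.span ℝ P, IsLat (a : Fin n → ℝ) → ∃ z : ℤ, φ a = (z : ℝ)

/-- `P^∨` is a lattice polyhedron: every vertex (= extreme point) of `P^∨` lies in the
dual integer lattice. -/
def DualIsLatticePolyhedron (P : Set (Fin n → ℝ)) : Prop :=
  ∀ φ ∈ Set.extremePoints ℝ (dualSet P), IsDualLatticePt P φ

/-- `den(P^∨)`: the smallest positive integer `d` such that `d • P^∨` is a lattice
polyhedron. -/
def dualDen (P : Set (Fin n → ℝ)) : ℕ :=
  sInf {d : ℕ | 0 < d ∧ ∀ φ ∈ Set.extremePoints ℝ (dualSet P), IsDualLatticePt P ((d : ℝ) • φ)}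

/-- `L_P(k)`, with `L_P(0) = 1`. -/
def ehr (P : Set (Fin n → ℝ)) (k : ℕ) : ℕ :=
  if k = 0 then 1 else Set.ncard (latt ((k : ℝ) • P))

/-- The coefficientwise form of `Ehr_{P⊕Q}(t) = (1-t) Ehr_P(t) Ehr_Q(t)`. -/
def EhrEq (P Q : Set (Fin n → ℝ)) : Prop :=
  ∀ k : ℕ,
    (ehr (convexHull ℝ (P ∪ Q)) k : ℤ) =
      (∑ i ∈ Finset.range (k + 1), (ehr P i : ℤ) * (ehr Q (k - i) : ℤ)) -
        ∑ i ∈ Finset.range k, (ehr P i : ℤ) * (ehr Q (k - 1 - i) : ℤ)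

/-- `P` is reflexive: a lattice polytope containing the origin in its relative interior
whose polar dual is a lattice polytope. -/
def IsReflexive (P : Set (Fin n → ℝ)) : Prop :=
  IsLatPolytope P ∧ (0 : Fin n → ℝ) ∈ intrinsicInterior ℝ P ∧ DualIsLatticePolyhedron P

/-- `P` is Gorenstein of index `k`. -/
def IsGorenstein (P : Set (Fin n → ℝ)) (k : ℕ) : Prop :=
  IsLatPolytope P ∧ 0 < k ∧
    ∃ m : Fin n → ℝ, IsLat m ∧ IsReflexive ((fun x => x - m) '' ((k : ℝ) • P))

/-- `p` is a rational point. -/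
def IsRatPt (p : Fin n → ℝ) : Prop := ∀ i, ∃ q : ℚ, p i = (q : ℝ)

/-- Membership in the lattice `Λ^p` generated by `e_1, …, e_n` and `p`. -/
def InLambda (p x : Fin n → ℝ) : Prop :=
  ∃ (z : Fin n → ℤ) (c : ℤ), x = (fun i => (z i : ℝ)) + (c : ℝ) • p

/-- `den(p)`: the lcm of the denominators of the coordinates of `p`, i.e. the least
positive integer `r` with `r • p` a lattice point. -/
def denPt (p : Fin n → ℝ) : ℕ := sInf {r : ℕ | 0 < r ∧ IsLat ((r : ℝ) • p)}

/-- The projection `ε^p_J` parallel to `α(p)` onto the `p`-lower envelope of `cone J`. -/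
def epsP (p : Fin n → ℝ) (J : Set (Fin n → ℝ)) (x : Fin (n + 1) → ℝ) : Fin (n + 1) → ℝ :=
  x - sSup {l : ℝ | x - l • emb p ∈ cone J} • emb p

/-- The `p`-lower envelope of `cone J`. -/
def plenv (p : Fin n → ℝ) (J : Set (Fin n → ℝ)) : Set (Fin (n + 1) → ℝ) := epsP p J '' cone J

/-- The `p`-lower lattice envelope of `cone J`. -/
def pllenv (p : Fin n → ℝ) (J : Set (Fin n → ℝ)) : Set (Fin (n + 1) → ℝ) :=
  epsP p J '' latt (cone J)

/-- `J ⊕ K` is an affine free sum with common (rational) point `p`. -/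
def IsAffineFreeSum (J K : Set (Fin n → ℝ)) (p : Fin n → ℝ) : Prop :=
  IsRatPt p ∧ p ∈ J ∧ p ∈ K ∧
    ((affineSpan ℝ J : Set (Fin n → ℝ)) ∩ (affineSpan ℝ K : Set (Fin n → ℝ)) = {p}) ∧
    ∀ m : Fin n → ℝ, m ∈ Submodule.span ℝ ((fun x => x - p) '' (J ∪ K)) → InLambda p m →
      ∃! q : (Fin n → ℝ) × (Fin n → ℝ),
        (q.1 ∈ Submodule.span ℝ ((fun x => x - p) '' J) ∧ InLambda p q.1) ∧
        (q.2 ∈ Submodule.span ℝ ((fun x => x - p) '' K) ∧ InLambda p q.2) ∧ m = q.1 + q.2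


/-! ### Abstract polyhedral duality -/

lemma ext_of_span {W : Type*} [AddCommGroup W] [Module ℝ W] {ι : Type*} (v : ι → W)
    (φ : Module.Dual ℝ W) (hφ : ∀ i, φ (v i) ≤ 1)
    (hs : Submodule.span ℝ (v '' {i | φ (v i) = 1}) = ⊤) :
    φ ∈ Set.extremePoints ℝ {φ : Module.Dual ℝ W | ∀ i, φ (v i) ≤ 1} := by
  rw [mem_extremePoints]
  refine ⟨hφ, ?_⟩
  rintro φ₁ h₁ φ₂ h₂ ⟨a, b, ha, hb, hab, rfl⟩
  simp only [Set.mem_ofPred_eq] at h₁ h₂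
  have key : ∀ i, a * φ₁ (v i) + b * φ₂ (v i) = 1 → φ₁ (v i) = 1 ∧ φ₂ (v i) = 1 := by
    intro i hi
    have e1 := h₁ i
    have e2 := h₂ i
    constructor
    · by_contra hne
      have : φ₁ (v i) < 1 := lt_of_le_of_ne e1 hne
      nlinarith
    · by_contra hne
      have : φ₂ (v i) < 1 := lt_of_le_of_ne e2 hne
      nlinarith
  constructor
  · apply LinearMap.ext_on hs
    rintro _ ⟨i, hi, rfl⟩
    have hi' : a * φ₁ (v i) + b * φ₂ (v i) = 1 := by simpa using hi
    have := key i hi'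
    simp [this, hab]
  · apply LinearMap.ext_on hs
    rintro _ ⟨i, hi, rfl⟩
    have hi' : a * φ₁ (v i) + b * φ₂ (v i) = 1 := by simpa using hi
    have := key i hi'
    simp [this, hab]

lemma span_of_ext {W : Type*} [AddCommGroup W] [Module ℝ W] {ι : Type*} [Finite ι] (v : ι → W)
    (φ : Module.Dual ℝ W)
    (h : φ ∈ Set.extremePoints ℝ {φ : Module.Dual ℝ W | ∀ i, φ (v i) ≤ 1}) :
    Submodule.span ℝ (v '' {i | φ (v i) = 1}) = ⊤ := by
  by_contra hne
  obtain ⟨ψ, hψ0, hψ⟩ := Submodule.exists_le_ker_of_lt_top _ (lt_top_iff_ne_top.mpr hne)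
  rw [mem_extremePoints] at h
  obtain ⟨hφ, hext⟩ := h
  simp only [Set.mem_ofPred_eq] at hφ
  have hz : ∀ i, φ (v i) = 1 → ψ (v i) = 0 := by
    intro i hi
    have : v i ∈ Submodule.span ℝ (v '' {i | φ (v i) = 1}) :=
      Submodule.subset_span ⟨i, hi, rfl⟩
    simpa using hψ this
  have hex : ∃ ε : ℝ, 0 < ε ∧ ∀ i, ε * |ψ (v i)| ≤ 1 - φ (v i) := by
    have h1 : ∀ i, ∃ ε : ℝ, 0 < ε ∧ ε * |ψ (v i)| ≤ 1 - φ (v i) := by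
      intro i
      rcases eq_or_lt_of_le (hφ i) with h | h
      · exact ⟨1, one_pos, by simp [hz i h, h]⟩
      · refine ⟨(1 - φ (v i)) / (|ψ (v i)| + 1), by
          have := abs_nonneg (ψ (v i))
          apply div_pos <;> linarith, ?_⟩
        have := abs_nonneg (ψ (v i))
        rw [div_mul_eq_mul_div, div_le_iff₀ (by linarith)]
        nlinarith
    choose ε hε hle using h1
    obtain ⟨δ, hδ, hδε⟩ : ∃ δ : ℝ, 0 < δ ∧ ∀ i, δ ≤ ε i := by
      cases isEmpty_or_nonempty ι
      · exact ⟨1, one_pos, fun i => isEmptyElim i⟩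
      · obtain ⟨j, hj⟩ := Finite.exists_min ε
        exact ⟨ε j, hε j, hj⟩
    exact ⟨δ, hδ, fun i => (mul_le_mul_of_nonneg_right (hδε i) (abs_nonneg _)).trans (hle i)⟩
  obtain ⟨ε, hε, hle⟩ := hex
  have hp : φ + ε • ψ ∈ {φ : Module.Dual ℝ W | ∀ i, φ (v i) ≤ 1} := by
    intro i
    have := hle i
    have h2 := le_abs_self (ψ (v i))
    simp only [LinearMap.add_apply, LinearMap.smul_apply, smul_eq_mul]
    nlinarith
  have hm : φ - ε • ψ ∈ {φ : Module.Dual ℝ W | ∀ i, φ (v i) ≤ 1} := by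
    intro i
    have := hle i
    have h2 := neg_le_abs (ψ (v i))
    simp only [LinearMap.sub_apply, LinearMap.smul_apply, smul_eq_mul]
    nlinarith
  have := (hext _ hp _ hm ⟨1/2, 1/2, by norm_num, by norm_num, by norm_num, by module⟩).1
  have h0 : ε • ψ = 0 := by simpa using this
  rcases smul_eq_zero.mp h0 with h | h
  · exact hε.ne' h
  · exact hψ0 h

lemma exists_ext_ge {W : Type*} [AddCommGroup W] [Module ℝ W] {ι : Type*} [Fintype ι] (v : ι → W)
    (hv : Submodule.span ℝ (Set.range v) = ⊤) (c : ι → ℝ) (hc : ∀ i, 0 ≤ c i) :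
    ∀ (k : ℕ) (φ : Module.Dual ℝ W), (∀ i, φ (v i) ≤ 1) →
      (Finset.univ.filter (fun i => φ (v i) ≠ 1)).card = k →
      ∃ φ' ∈ Set.extremePoints ℝ {φ : Module.Dual ℝ W | ∀ i, φ (v i) ≤ 1},
        φ (∑ i, c i • v i) ≤ φ' (∑ i, c i • v i) := by
  intro k
  induction k using Nat.strong_induction_on with
  | _ k ih =>
  intro φ hφ hk
  by_cases hs : Submodule.span ℝ (v '' {i | φ (v i) = 1}) = ⊤
  · exact ⟨φ, ext_of_span v φ hφ hs, le_rfl⟩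
  obtain ⟨ψ₀, hψ0, hψ⟩ := Submodule.exists_le_ker_of_lt_top _ (lt_top_iff_ne_top.mpr hs)
  have hz0 : ∀ i, φ (v i) = 1 → ψ₀ (v i) = 0 := by
    intro i hi
    have : v i ∈ Submodule.span ℝ (v '' {i | φ (v i) = 1}) :=
      Submodule.subset_span ⟨i, hi, rfl⟩
    simpa using hψ this
  have hne : ∃ i, ψ₀ (v i) ≠ 0 := by
    by_contra hcon
    push Not at hcon
    apply hψ0
    apply LinearMap.ext_on hv
    rintro _ ⟨i, rfl⟩
    simpa using hcon i
  -- choose a good sign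
  obtain ⟨ψ, hz, hx, j, hj⟩ : ∃ ψ : Module.Dual ℝ W, (∀ i, φ (v i) = 1 → ψ (v i) = 0) ∧
      0 ≤ ψ (∑ i, c i • v i) ∧ ∃ j, 0 < ψ (v j) := by
    have pos : ∀ ψ : Module.Dual ℝ W, 0 < ψ (∑ i, c i • v i) → ∃ j, 0 < ψ (v j) := by
      intro ψ h
      by_contra hcon
      push Not at hcon
      have : ψ (∑ i, c i • v i) ≤ 0 := by
        rw [map_sum]
        apply Finset.sum_nonpos
        intro i _
        rw [map_smul, smul_eq_mul]
        exact mul_nonpos_of_nonneg_of_nonpos (hc i) (hcon i)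
      linarith
    rcases lt_trichotomy (ψ₀ (∑ i, c i • v i)) 0 with h | h | h
    · have h' : 0 < (-ψ₀) (∑ i, c i • v i) := by rw [LinearMap.neg_apply]; linarith
      exact ⟨-ψ₀, fun i hi => by simp [hz0 i hi], h'.le, pos _ h'⟩
    · obtain ⟨i, hi⟩ := hne
      rcases lt_or_gt_of_ne hi with h1 | h1
      · exact ⟨-ψ₀, fun i hi => by simp [hz0 i hi], by rw [LinearMap.neg_apply]; linarith,
          i, by rw [LinearMap.neg_apply]; linarith⟩
      · exact ⟨ψ₀, hz0, h.ge, i, h1⟩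
    · exact ⟨ψ₀, hz0, h.le, pos _ h⟩
  obtain ⟨i₀, hi₀, hmin⟩ := Finset.exists_min_image
    (Finset.univ.filter (fun i => 0 < ψ (v i))) (fun i => (1 - φ (v i)) / ψ (v i))
    ⟨j, by simpa using hj⟩
  simp only [Finset.mem_filter, Finset.mem_univ, true_and] at hi₀ hmin
  set t := (1 - φ (v i₀)) / ψ (v i₀) with ht
  have ht0 : 0 ≤ t := div_nonneg (by linarith [hφ i₀]) hi₀.le
  have happ : ∀ x, (φ + t • ψ) x = φ x + t * ψ x := by intro x; simp
  have hφ' : ∀ i, (φ + t • ψ) (v i) ≤ 1 := by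
    intro i
    rw [happ]
    rcases le_or_gt (ψ (v i)) 0 with h | h
    · have := mul_nonpos_of_nonneg_of_nonpos ht0 h
      linarith [hφ i]
    · have := hmin i h
      rw [le_div_iff₀ h] at this
      linarith
  have htight : (φ + t • ψ) (v i₀) = 1 := by
    rw [happ, ht, div_mul_cancel₀ _ hi₀.ne']; ring
  have hlt : (Finset.univ.filter (fun i => (φ + t • ψ) (v i) ≠ 1)).card < k := by
    rw [← hk]
    apply Finset.card_lt_card
    refine ⟨?_, ?_⟩
    · intro i
      simp only [Finset.mem_filter, Finset.mem_univ, true_and]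
      intro h h1
      apply h
      rw [happ, hz i h1, h1]; ring
    · intro hsub
      have : i₀ ∈ Finset.univ.filter (fun i => φ (v i) ≠ 1) := by
        simp only [Finset.mem_filter, Finset.mem_univ, true_and]
        intro h1
        have := hz i₀ h1
        linarith
      have := hsub this
      simp only [Finset.mem_filter, Finset.mem_univ, true_and] at this
      exact this htight
  obtain ⟨φ', h1, h2⟩ := ih _ hlt _ hφ' rfl
  refine ⟨φ', h1, le_trans ?_ h2⟩
  rw [happ]
  have := mul_nonneg ht0 hx
  linarith

/-! ### Height function of the cone -/

/-- `(x, t)` lies in the cone over `P`. -/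
def InC (P : Set (Fin n → ℝ)) (x : Fin n → ℝ) (t : ℝ) : Prop := ∃ a ∈ P, 0 ≤ t ∧ x = t • a

/-- `g` is the smallest height at which `x` lies in the cone over `P`. -/
def IsG (P : Set (Fin n → ℝ)) (x : Fin n → ℝ) (g : ℝ) : Prop := ∀ t, InC P x t ↔ g ≤ t

lemma IsG.inC {P : Set (Fin n → ℝ)} {x : Fin n → ℝ} {g : ℝ} (h : IsG P x g) : InC P x g :=
  (h g).2 le_rfl

lemma IsG.nonneg {P : Set (Fin n → ℝ)} {x : Fin n → ℝ} {g : ℝ} (h : IsG P x g) : 0 ≤ g := by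
  obtain ⟨a, _, h0, _⟩ := h.inC
  exact h0

lemma InC.mem_span {P : Set (Fin n → ℝ)} {x : Fin n → ℝ} {t : ℝ} (h : InC P x t) :
    x ∈ Submodule.span ℝ P := by
  obtain ⟨a, ha, _, rfl⟩ := h
  exact Submodule.smul_mem _ _ (Submodule.subset_span ha)

lemma InC.mono {P : Set (Fin n → ℝ)} (hc : Convex ℝ P) (h0 : (0 : Fin n → ℝ) ∈ P)
    {x : Fin n → ℝ} {t s : ℝ} (h : InC P x t) (hts : t ≤ s) : InC P x s := by
  obtain ⟨a, ha, ht, rfl⟩ := h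
  rcases eq_or_lt_of_le ht with h | h
  · subst h
    exact ⟨0, h0, hts, by simp⟩
  · have hs : 0 < s := lt_of_lt_of_le h hts
    refine ⟨(t / s) • a, hc.smul_mem_of_zero_mem h0 ha ⟨by positivity, ?_⟩, hs.le, ?_⟩
    · rw [div_le_one hs]; exact hts
    · rw [smul_smul, mul_div_cancel₀ _ hs.ne']

lemma exists_isG {P : Set (Fin n → ℝ)} (hc : Convex ℝ P) (hK : IsCompact P)
    (h0 : (0 : Fin n → ℝ) ∈ P) {x : Fin n → ℝ} {t : ℝ} (h : InC P x t) : ∃ g, IsG P x g := by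
  have hcomp : IsCompact ((Set.Icc 0 t ×ˢ P) ∩ {q : ℝ × (Fin n → ℝ) | x = q.1 • q.2}) :=
    (isCompact_Icc.prod hK).inter_right
      (isClosed_eq continuous_const (continuous_fst.smul continuous_snd))
  have hS := hcomp.image continuous_fst
  obtain ⟨a, ha, ht, hx⟩ := h
  obtain ⟨g, hg, hmin⟩ := hS.exists_isLeast ⟨t, (t, a), ⟨⟨⟨ht, le_rfl⟩, ha⟩, hx⟩, rfl⟩
  obtain ⟨⟨g', b⟩, ⟨⟨⟨hg0, hgt⟩, hb⟩, hxb⟩, rfl⟩ := hg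
  refine ⟨g', fun s => ⟨?_, fun hs => InC.mono hc h0 ⟨b, hb, hg0, hxb⟩ hs⟩⟩
  rintro ⟨d, hd, hs, hxd⟩
  rcases le_total s t with hst | hst
  · exact hmin ⟨(s, d), ⟨⟨⟨hs, hst⟩, hd⟩, hxd⟩, rfl⟩
  · exact le_trans hgt hst

lemma isG_smul {P : Set (Fin n → ℝ)} {x : Fin n → ℝ} {g c : ℝ} (hc : 0 < c) (h : IsG P x g) :
    IsG P (c • x) (c * g) := by
  intro t
  have : InC P (c • x) t ↔ InC P x (c⁻¹ * t) := by
    constructor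
    · rintro ⟨a, ha, ht, hx⟩
      exact ⟨a, ha, by positivity, by rw [mul_smul, ← hx, smul_smul, inv_mul_cancel₀ hc.ne', one_smul]⟩
    · rintro ⟨a, ha, ht, hx⟩
      refine ⟨a, ha, ?_, by rw [hx, smul_smul, mul_inv_cancel_left₀ hc.ne']⟩
      by_contra hneg
      push Not at hneg
      have := mul_neg_of_pos_of_neg (inv_pos.mpr hc) hneg
      linarith
  rw [this, h, le_inv_mul_iff₀ hc]

lemma inC_sum {V : Finset (Fin n → ℝ)} (h0 : (0 : Fin n → ℝ) ∈ convexHull ℝ (V : Set (Fin n → ℝ)))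
    (c : V → ℝ) (hc : ∀ i, 0 ≤ c i) :
    InC (convexHull ℝ (V : Set (Fin n → ℝ))) (∑ i, c i • (i : Fin n → ℝ)) (∑ i, c i) := by
  have hs : 0 ≤ ∑ i, c i := Finset.sum_nonneg fun i _ => hc i
  rcases eq_or_lt_of_le hs with h | h
  · have hz := (Finset.sum_eq_zero_iff_of_nonneg fun i _ => hc i).1 h.symm
    refine ⟨0, h0, hs, ?_⟩
    rw [smul_zero]
    exact Finset.sum_eq_zero fun i hi => by rw [hz i hi, zero_smul]
  · refine ⟨∑ i, ((∑ i, c i)⁻¹ * c i) • (i : Fin n → ℝ), ?_, hs, ?_⟩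
    · apply (convex_convexHull ℝ _).sum_mem
      · intro i _
        have := hc i
        positivity
      · rw [← Finset.mul_sum, inv_mul_cancel₀ h.ne']
      · intro i _
        exact subset_convexHull ℝ _ i.2
    · rw [Finset.smul_sum]
      refine Finset.sum_congr rfl fun i _ => ?_
      rw [smul_smul, mul_inv_cancel_left₀ h.ne']

lemma exists_sum_of_inC {V : Finset (Fin n → ℝ)} {x : Fin n → ℝ} {t : ℝ}
    (h : InC (convexHull ℝ (V : Set (Fin n → ℝ))) x t) :
    ∃ c : V → ℝ, (∀ i, 0 ≤ c i) ∧ ∑ i, c i = t ∧ x = ∑ i, c i • (i : Fin n → ℝ) := by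
  obtain ⟨a, ha, ht, rfl⟩ := h
  rw [Finset.mem_convexHull'] at ha
  obtain ⟨w, hw, hw1, rfl⟩ := ha
  refine ⟨fun i => t * w i, fun i => mul_nonneg ht (hw i i.2), ?_, ?_⟩
  · rw [← Finset.mul_sum, Finset.sum_coe_sort V w, hw1, mul_one]
  · rw [Finset.sum_coe_sort V (fun i => (t * w i) • i), Finset.smul_sum]
    simp_rw [smul_smul]

/-- The generators as elements of the linear span. -/
def gen {V : Finset (Fin n → ℝ)} (i : V) :
    Submodule.span ℝ (convexHull ℝ (V : Set (Fin n → ℝ))) :=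
  ⟨i, Submodule.subset_span (subset_convexHull ℝ _ i.2)⟩

lemma span_gen {V : Finset (Fin n → ℝ)} :
    Submodule.span ℝ (Set.range (gen (V := V))) = ⊤ := by
  apply Submodule.map_injective_of_injective (Submodule.injective_subtype
    (Submodule.span ℝ (convexHull ℝ (V : Set (Fin n → ℝ)))))
  rw [Submodule.map_span, Submodule.map_top, Submodule.range_subtype, ← Set.range_comp]
  have : Set.range (⇑(Submodule.subtype (Submodule.span ℝ (convexHull ℝ (V : Set (Fin n → ℝ)))))
      ∘ gen) = (V : Set (Fin n → ℝ)) := by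
    ext x
    simp [gen]
  rw [this]
  apply le_antisymm
  · exact Submodule.span_mono (subset_convexHull ℝ _)
  · rw [Submodule.span_le]
    exact convexHull_min Submodule.subset_span (Submodule.convex _)

lemma dual_le_of_inC {P : Set (Fin n → ℝ)} {φ : Module.Dual ℝ (Submodule.span ℝ P)}
    (hφ : φ ∈ dualSet P) (x : Submodule.span ℝ P) {t : ℝ} (h : InC P x t) : φ x ≤ t := by
  obtain ⟨a, ha, ht, hx⟩ := h
  have : x = t • (⟨a, Submodule.subset_span ha⟩ : Submodule.span ℝ P) := Subtype.ext hx
  rw [this, map_smul, smul_eq_mul]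
  have := hφ ⟨a, Submodule.subset_span ha⟩ ha
  nlinarith

lemma dualSet_eq (V : Finset (Fin n → ℝ)) :
    dualSet (convexHull ℝ (V : Set (Fin n → ℝ))) =
      {φ | ∀ i : V, φ (gen i) ≤ 1} := by
  ext φ
  constructor
  · intro h i
    exact h (gen i) (subset_convexHull ℝ _ i.2)
  · intro h a ha
    obtain ⟨c, hc, hc1, hx⟩ := exists_sum_of_inC (V := V) (x := a) (t := 1)
      ⟨a, ha, zero_le_one, by simp⟩
    have : a = ∑ i, c i • gen i := by
      apply Subtype.ext
      rw [hx]
      simp [gen]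
    rw [this, map_sum, ← hc1]
    apply Finset.sum_le_sum
    intro i _
    rw [map_smul, smul_eq_mul]
    have := h i
    have := hc i
    nlinarith [h i]

lemma isG_int_of_dual (V : Finset (Fin n → ℝ))
    (h0 : (0 : Fin n → ℝ) ∈ convexHull ℝ (V : Set (Fin n → ℝ)))
    (hd : DualIsLatticePolyhedron (convexHull ℝ (V : Set (Fin n → ℝ))))
    {x : Fin n → ℝ} {g : ℝ} (hx : IsLat x)
    (hg : IsG (convexHull ℝ (V : Set (Fin n → ℝ))) x g) : ∃ z : ℤ, g = z := by
  by_contra hcon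
  have hfl : (⌊g⌋ : ℝ) < g := lt_of_le_of_ne (Int.floor_le g) fun h => hcon ⟨_, h.symm⟩
  obtain ⟨t, ht1, ht2⟩ := exists_between hfl
  have ht : 0 < t := lt_of_le_of_lt (by exact_mod_cast Int.floor_nonneg.mpr hg.nonneg) ht1
  have hnot : t⁻¹ • x ∉ convexHull ℝ (V : Set (Fin n → ℝ)) := by
    intro hmem
    have : InC (convexHull ℝ (V : Set (Fin n → ℝ))) x t :=
      ⟨_, hmem, ht.le, by rw [smul_smul, mul_inv_cancel₀ ht.ne', one_smul]⟩
    rw [hg] at this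
    linarith
  obtain ⟨f, u, hfu, hux⟩ := geometric_hahn_banach_closed_point (convex_convexHull ℝ _)
    (V.finite_toSet.isCompact_convexHull ℝ).isClosed hnot
  have hu : 0 < u := by simpa using hfu 0 h0
  have hxs := hg.inC.mem_span
  set φ : Module.Dual ℝ (Submodule.span ℝ (convexHull ℝ (V : Set (Fin n → ℝ)))) :=
    u⁻¹ • ((f : (Fin n → ℝ) →ₗ[ℝ] ℝ) ∘ₗ Submodule.subtype _) with hφ
  have hφa : ∀ a, φ a = u⁻¹ * f a := by intro a; simp [hφ]
  have hφD : φ ∈ dualSet (convexHull ℝ (V : Set (Fin n → ℝ))) := by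
    intro a ha
    rw [hφa, inv_mul_le_iff₀ hu]
    linarith [hfu a ha]
  have hφx : t < φ ⟨x, hxs⟩ := by
    rw [hφa, lt_inv_mul_iff₀ hu]
    simp only [map_smul, smul_eq_mul] at hux
    rw [lt_inv_mul_iff₀ ht] at hux
    linarith
  obtain ⟨c, hc, _, hxc⟩ := exists_sum_of_inC hg.inC
  have hxc' : (⟨x, hxs⟩ : Submodule.span ℝ (convexHull ℝ (V : Set (Fin n → ℝ)))) =
      ∑ i, c i • gen i := by
    apply Subtype.ext
    simpa [gen] using hxc
  have hD := hφD
  rw [dualSet_eq] at hD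
  obtain ⟨φ', hφ', hle⟩ := exists_ext_ge gen span_gen c hc _ φ hD rfl
  rw [← dualSet_eq] at hφ'
  rw [← hxc'] at hle
  obtain ⟨z, hz⟩ := hd φ' hφ' ⟨x, hxs⟩ hx
  have h1 : φ' ⟨x, hxs⟩ ≤ g := dual_le_of_inC hφ'.1 ⟨x, hxs⟩ hg.inC
  have h2 : (⌊g⌋ : ℝ) < z := by rw [← hz]; linarith
  have h3 : z ≤ ⌊g⌋ := by
    rw [Int.le_floor, ← hz]; exact h1
  have h4 : ⌊g⌋ < z := by exact_mod_cast h2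
  omega

lemma IsLat.add {m : ℕ} {x y : Fin m → ℝ} (hx : IsLat x) (hy : IsLat y) : IsLat (x + y) := by
  intro i
  obtain ⟨a, ha⟩ := hx i
  obtain ⟨b, hb⟩ := hy i
  exact ⟨a + b, by simp [ha, hb]⟩

lemma IsLat.nsmul {m : ℕ} {x : Fin m → ℝ} (k : ℕ) (hx : IsLat x) : IsLat ((k : ℝ) • x) := by
  intro i
  obtain ⟨a, ha⟩ := hx i
  exact ⟨k * a, by simp [ha]⟩

lemma IsLat.neg {m : ℕ} {x : Fin m → ℝ} (hx : IsLat x) : IsLat (-x) := by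
  intro i
  obtain ⟨a, ha⟩ := hx i
  exact ⟨-a, by simp [ha]⟩

lemma IsLat.sum {m : ℕ} {ι : Type*} (s : Finset ι) (f : ι → Fin m → ℝ) (h : ∀ i ∈ s, IsLat (f i)) :
    IsLat (∑ i ∈ s, f i) := by
  induction s using Finset.induction_on with
  | empty => intro i; exact ⟨0, by simp⟩
  | insert a s ha ih =>
    rw [Finset.sum_insert ha]
    exact (h a (by simp)).add (ih fun i hi => h i (by simp [hi]))

lemma exists_den {m : ℕ} (x : Fin m → ℝ) (hx : ∀ i, ∃ q : ℚ, x i = (q : ℝ)) :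
    ∃ k : ℕ, 0 < k ∧ IsLat ((k : ℝ) • x) := by
  choose q hq using hx
  refine ⟨∏ i, (q i).den, Finset.prod_pos fun i _ => (q i).den_pos, fun i => ?_⟩
  obtain ⟨r, hr⟩ := Finset.dvd_prod_of_mem (fun i => (q i).den) (Finset.mem_univ i)
  refine ⟨r * (q i).num, ?_⟩
  have h1 : ((q i : ℚ) : ℝ) * ((q i).den : ℝ) = ((q i).num : ℝ) := by
    exact_mod_cast Rat.mul_den_eq_num (q i)
  rw [Pi.smul_apply, smul_eq_mul, hq, hr]
  push_cast
  rw [← h1]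
  ring

lemma dual_of_isG_int (V : Finset (Fin n → ℝ))
    (h0 : (0 : Fin n → ℝ) ∈ convexHull ℝ (V : Set (Fin n → ℝ)))
    (hV : ∀ v ∈ V, ∀ i, ∃ q : ℚ, v i = (q : ℝ))
    (hg : ∀ x g, IsLat x → IsG (convexHull ℝ (V : Set (Fin n → ℝ))) x g → ∃ z : ℤ, g = z) :
    DualIsLatticePolyhedron (convexHull ℝ (V : Set (Fin n → ℝ))) := by
  intro φ hφ a ha
  have hφD := hφ.1
  have hspan : Submodule.span ℝ (gen '' {i : V | φ (gen i) = 1}) = ⊤ := by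
    apply span_of_ext
    rw [← dualSet_eq]
    exact hφ
  -- on the cone over the tight generators, `φ` computes the height
  have key : ∀ c : V → ℝ, (∀ i, 0 ≤ c i) → (∀ i, φ (gen i) ≠ 1 → c i = 0) →
      IsLat (∑ i, c i • (i : Fin n → ℝ)) → ∃ z : ℤ, φ (∑ i, c i • gen i) = z := by
    intro c hc hc0 hlat
    have hin := inC_sum h0 c hc
    obtain ⟨g, hG⟩ := exists_isG (convex_convexHull ℝ _) (V.finite_toSet.isCompact_convexHull ℝ)
      h0 hin
    have hco : ((∑ i, c i • gen i : Submodule.span ℝ (convexHull ℝ (V : Set (Fin n → ℝ)))) :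
        Fin n → ℝ) = ∑ i, c i • (i : Fin n → ℝ) := by simp [gen]
    have hval : φ (∑ i, c i • gen i) = ∑ i, c i := by
      rw [map_sum]
      refine Finset.sum_congr rfl fun i _ => ?_
      rw [map_smul, smul_eq_mul]
      by_cases h : φ (gen i) = 1
      · rw [h, mul_one]
      · rw [hc0 i h, zero_mul]
    have h1 : φ (∑ i, c i • gen i) ≤ g := by
      apply dual_le_of_inC hφD
      rw [hco]
      exact hG.inC
    have h2 : g ≤ ∑ i, c i := (hG _).1 hin
    obtain ⟨z, hz⟩ := hg _ _ hlat hG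
    exact ⟨z, by linarith⟩
  -- write `a` in terms of tight generators
  have hmem : a ∈ Submodule.span ℝ (gen '' {i : V | φ (gen i) = 1}) := by
    rw [hspan]; trivial
  obtain ⟨c, hc0, hca⟩ : ∃ c : V → ℝ, (∀ i, φ (gen i) ≠ 1 → c i = 0) ∧ a = ∑ i, c i • gen i := by
    refine Submodule.span_induction (p := fun a _ => ∃ c : V → ℝ,
      (∀ i, φ (gen i) ≠ 1 → c i = 0) ∧ a = ∑ i, c i • gen i) ?_ ?_ ?_ ?_ hmem
    · rintro _ ⟨j, hj, rfl⟩
      refine ⟨Pi.single j 1, fun i hi => ?_, ?_⟩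
      · apply Pi.single_eq_of_ne
        rintro rfl
        exact hi hj
      · rw [Finset.sum_eq_single j] <;> simp +contextual
    · exact ⟨0, by simp, by simp⟩
    · rintro x y _ _ ⟨c, h1, rfl⟩ ⟨d, h2, rfl⟩
      exact ⟨c + d, fun i hi => by simp [h1 i hi, h2 i hi], by simp [add_smul, Finset.sum_add_distrib]⟩
    · rintro r x _ ⟨c, h1, rfl⟩
      exact ⟨r • c, fun i hi => by simp [h1 i hi], by simp [mul_smul, Finset.smul_sum]⟩
  have hden : ∀ i : V, ∃ k : ℕ, 0 < k ∧ IsLat ((k : ℝ) • (i : Fin n → ℝ)) := fun i =>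
    exists_den _ (hV i i.2)
  choose N hN hNl using hden
  have hM : ∀ i : V, ∃ M : ℕ, |c i| ≤ M := fun i => exists_nat_ge _
  choose M hM using hM
  set d : V → ℝ := fun i => if φ (gen i) = 1 then (M i : ℝ) * N i else 0 with hd
  have hd0 : ∀ i, 0 ≤ d i := by
    intro i
    simp only [hd]
    split_ifs <;> positivity
  have hdl : IsLat (∑ i, d i • (i : Fin n → ℝ)) := by
    apply IsLat.sum
    intro i _
    simp only [hd]
    split_ifs
    · rw [mul_smul]
      exact (hNl i).nsmul _
    · intro j; exact ⟨0, by simp⟩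
  have hsum : (∑ i, (c i + d i) • (i : Fin n → ℝ)) = a + ∑ i, d i • (i : Fin n → ℝ) := by
    rw [hca]
    simp [gen, add_smul, Finset.sum_add_distrib]
  obtain ⟨z1, hz1⟩ := key d hd0 (fun i hi => by simp [hd, hi]) hdl
  obtain ⟨z2, hz2⟩ := key (fun i => c i + d i) (fun i => by
      by_cases h : φ (gen i) = 1
      · have h1 := hM i
        have h2 := neg_abs_le (c i)
        have h3 : (1 : ℝ) ≤ N i := by exact_mod_cast hN i
        have h4 : (0 : ℝ) ≤ M i := by positivity
        simp only [hd, h, if_true]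
        nlinarith
      · simp [hd, h, hc0 i h]) (fun i hi => by simp [hd, hi, hc0 i hi])
    (by rw [hsum]; exact ha.add hdl)
  refine ⟨z2 - z1, ?_⟩
  push_cast
  rw [← hz1, ← hz2, ← map_sub, ← Finset.sum_sub_distrib]
  simp only [add_smul, add_sub_cancel_right]
  rw [← hca]

/-! ### Independence of the two linear spans -/

lemma coord_mem_span (V : Finset (Fin n → ℝ)) (hV : ∀ v ∈ V, ∀ i, ∃ q : ℚ, v i = (q : ℝ))
    (f : ℝ →ₗ[ℚ] ℚ) {y : Fin n → ℝ} (hy : y ∈ Submodule.span ℝ (V : Set (Fin n → ℝ))) :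
    (fun i => ((f (y i) : ℚ) : ℝ)) ∈ Submodule.span ℝ (V : Set (Fin n → ℝ)) := by
  rw [Submodule.mem_span_finset] at hy
  obtain ⟨c, _, rfl⟩ := hy
  have : (fun i => ((f ((∑ a ∈ V, c a • a) i) : ℚ) : ℝ)) = ∑ a ∈ V, ((f (c a) : ℚ) : ℝ) • a := by
    ext i
    simp only [Finset.sum_apply, Pi.smul_apply, smul_eq_mul, map_sum, Rat.cast_sum]
    refine Finset.sum_congr rfl fun a ha => ?_
    obtain ⟨q, hq⟩ := hV a ha i
    have : c a * a i = q • c a := by rw [hq, Rat.smul_def, mul_comm]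
    rw [this, map_smul, hq, smul_eq_mul]
    push_cast
    ring
  rw [this]
  exact Submodule.sum_mem _ fun a ha => Submodule.smul_mem _ _ (Submodule.subset_span ha)

lemma span_hull (V : Set (Fin n → ℝ)) :
    Submodule.span ℝ (convexHull ℝ V) = Submodule.span ℝ V := by
  apply le_antisymm
  · rw [Submodule.span_le]
    exact convexHull_min Submodule.subset_span (Submodule.convex _)
  · exact Submodule.span_mono (subset_convexHull ℝ _)

lemma span_disj {P Q : Set (Fin n → ℝ)} (hP : IsRatPolytope P) (hQ : IsRatPolytope Q)
    (hfree : IsFreeSum P Q) {y : Fin n → ℝ} (h1 : y ∈ Submodule.span ℝ P)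
    (h2 : y ∈ Submodule.span ℝ Q) : y = 0 := by
  obtain ⟨V, hV, rfl⟩ := hP
  obtain ⟨U, hU, rfl⟩ := hQ
  obtain ⟨_, _, huniq⟩ := hfree
  rw [span_hull] at h1 h2
  ext i
  rw [Pi.zero_apply, ← Module.forall_dual_apply_eq_zero_iff ℚ]
  intro f
  have e1 := coord_mem_span V hV f h1
  have e2 := coord_mem_span U hU f h2
  obtain ⟨k, hk, hlat⟩ := exists_den (fun i => ((f (y i) : ℚ) : ℝ)) (fun i => ⟨_, rfl⟩)
  obtain ⟨q, -, hq⟩ := huniq 0 (Submodule.zero_mem _) (fun i => ⟨0, by simp⟩)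
  have a1 := hq (0, 0) ⟨⟨Submodule.zero_mem _, fun i => ⟨0, by simp⟩⟩,
    ⟨Submodule.zero_mem _, fun i => ⟨0, by simp⟩⟩, by simp⟩
  have a2 := hq ((k : ℝ) • (fun i => ((f (y i) : ℚ) : ℝ)), -((k : ℝ) • (fun i => ((f (y i) : ℚ) : ℝ))))
    ⟨⟨by rw [span_hull]; exact Submodule.smul_mem _ _ e1, hlat⟩,
    ⟨by rw [span_hull]; exact Submodule.neg_mem _ (Submodule.smul_mem _ _ e2), hlat.neg⟩, by simp⟩
  have a3 := congrArg Prod.fst (a2.trans a1.symm)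
  have a4 := congrFun a3 i
  have hk' : (k : ℝ) ≠ 0 := by exact_mod_cast hk.ne'
  simpa [hk'] using a4

/-! ### Counting -/

lemma mem_cone_iff {K : Set (Fin n → ℝ)} (m : Fin (n + 1) → ℝ) :
    m ∈ cone K ↔ InC K (fun i => m i.castSucc) (m (Fin.last n)) := by
  constructor
  · rintro ⟨l, a, ha, hl, rfl⟩
    refine ⟨a, ha, by simpa [emb] using hl, ?_⟩
    ext i
    simp [emb]
  · rintro ⟨a, ha, hl, hx⟩
    refine ⟨_, a, ha, hl, ?_⟩
    ext i
    refine Fin.lastCases ?_ (fun j => ?_) i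
    · simp [emb]
    · simpa [emb] using congrFun hx j

lemma inC_union {P Q : Set (Fin n → ℝ)} (hP : Convex ℝ P) (hQ : Convex ℝ Q)
    (h0P : (0 : Fin n → ℝ) ∈ P) (h0Q : (0 : Fin n → ℝ) ∈ Q) (x : Fin n → ℝ) (t : ℝ) :
    InC (convexHull ℝ (P ∪ Q)) x t ↔
      ∃ y₁ t₁ y₂ t₂, InC P y₁ t₁ ∧ InC Q y₂ t₂ ∧ x = y₁ + y₂ ∧ t = t₁ + t₂ := by
  have hmem : ∀ a, a ∈ convexHull ℝ (P ∪ Q) ↔ ∃ p ∈ P, ∃ q ∈ Q, a ∈ segment ℝ p q := by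
    intro a
    rw [convexHull_union ⟨0, h0P⟩ ⟨0, h0Q⟩, hP.convexHull_eq, hQ.convexHull_eq, mem_convexJoin]
  constructor
  · rintro ⟨a, ha, ht, rfl⟩
    obtain ⟨p, hp, q, hq, α, β, hα, hβ, hαβ, rfl⟩ := (hmem a).1 ha
    refine ⟨(t * α) • p, t * α, (t * β) • q, t * β, ⟨p, hp, by positivity, rfl⟩,
      ⟨q, hq, by positivity, rfl⟩, by rw [smul_add, smul_smul, smul_smul], ?_⟩
    rw [← mul_add, hαβ, mul_one]
  · rintro ⟨_, t₁, _, t₂, ⟨p, hp, h1, rfl⟩, ⟨q, hq, h2, rfl⟩, rfl, rfl⟩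
    rcases eq_or_lt_of_le (add_nonneg h1 h2) with h | h
    · have e1 : t₁ = 0 := by linarith
      have e2 : t₂ = 0 := by linarith
      refine ⟨0, subset_convexHull ℝ _ (Or.inl h0P), h.le, by simp [e1, e2]⟩
    · refine ⟨(t₁ / (t₁ + t₂)) • p + (t₂ / (t₁ + t₂)) • q, (hmem _).2 ⟨p, hp, q, hq,
        t₁ / (t₁ + t₂), t₂ / (t₁ + t₂), by positivity, by positivity, ?_, rfl⟩, h.le, ?_⟩
      · rw [← add_div, div_self h.ne']
      · rw [smul_add, smul_smul, smul_smul, mul_div_cancel₀ _ h.ne', mul_div_cancel₀ _ h.ne']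

lemma mem_cone_sum {P Q : Set (Fin n → ℝ)} (hP : Convex ℝ P) (hQ : Convex ℝ Q)
    (h0P : (0 : Fin n → ℝ) ∈ P) (h0Q : (0 : Fin n → ℝ) ∈ Q)
    (hdisj : ∀ y, y ∈ Submodule.span ℝ P → y ∈ Submodule.span ℝ Q → y = 0)
    {x₁ x₂ : Fin n → ℝ} {g₁ g₂ : ℝ} (h₁ : IsG P x₁ g₁) (h₂ : IsG Q x₂ g₂) (t : ℝ) :
    InC (convexHull ℝ (P ∪ Q)) (x₁ + x₂) t ↔ g₁ + g₂ ≤ t := by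
  rw [inC_union hP hQ h0P h0Q]
  constructor
  · rintro ⟨y₁, t₁, y₂, t₂, a1, a2, hx, rfl⟩
    have e : x₁ - y₁ = y₂ - x₂ := by
      rw [sub_eq_sub_iff_add_eq_add, hx, add_comm]
    have hz : x₁ - y₁ = 0 := hdisj _ (Submodule.sub_mem _ h₁.inC.mem_span a1.mem_span)
      (by rw [e]; exact Submodule.sub_mem _ a2.mem_span h₂.inC.mem_span)
    have e1 : x₁ = y₁ := sub_eq_zero.mp hz
    have e2 : y₂ = x₂ := by rw [e] at hz; exact sub_eq_zero.mp hz
    subst e1 e2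
    exact add_le_add ((h₁ _).1 a1) ((h₂ _).1 a2)
  · intro h
    exact ⟨x₁, g₁, x₂, t - g₁, h₁.inC, (h₂ _).2 (by linarith), rfl, by ring⟩

lemma isLat_snoc {x : Fin n → ℝ} (hx : IsLat x) (t : ℤ) :
    IsLat (Fin.snoc x (t : ℝ) : Fin (n + 1) → ℝ) := by
  intro i
  refine Fin.lastCases ?_ (fun j => ?_) i
  · exact ⟨t, by simp⟩
  · obtain ⟨z, hz⟩ := hx j
    exact ⟨z, by simpa using hz⟩

lemma npairs_eq {P Q : Set (Fin n → ℝ)}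
    (hdisj : ∀ y, y ∈ Submodule.span ℝ P → y ∈ Submodule.span ℝ Q → y = 0)
    {x₁ x₂ : Fin n → ℝ} {g₁ g₂ : ℝ} (h₁ : IsG P x₁ g₁) (h₂ : IsG Q x₂ g₂)
    (l₁ : IsLat x₁) (l₂ : IsLat x₂) (m : Fin (n + 1) → ℤ)
    (hm : ∀ i : Fin n, (m i.castSucc : ℝ) = x₁ i + x₂ i) :
    Npairs P Q m = (m (Fin.last n) - ⌈g₂⌉ + 1 - ⌈g₁⌉).toNat := by
  set F : ℤ → (Fin (n + 1) → ℝ) × (Fin (n + 1) → ℝ) := fun t =>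
    (Fin.snoc x₁ (t : ℝ), Fin.snoc x₂ ((m (Fin.last n) - t : ℤ) : ℝ)) with hF
  have hinj : Function.Injective F := by
    intro s t hst
    have := congrFun (congrArg Prod.fst hst) (Fin.last n)
    simpa [hF] using this
  have hset : {q : (Fin (n + 1) → ℝ) × (Fin (n + 1) → ℝ) |
      q.1 ∈ latt (cone P) ∧ q.2 ∈ latt (cone Q) ∧ q.1 + q.2 = fun i => (m i : ℝ)} =
      F '' (Finset.Icc ⌈g₁⌉ (m (Fin.last n) - ⌈g₂⌉) : Finset ℤ) := by
    ext ⟨q₁, q₂⟩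
    constructor
    · rintro ⟨⟨c1, k1⟩, ⟨c2, k2⟩, hsum⟩
      simp only at c1 k1 c2 k2 hsum
      rw [mem_cone_iff] at c1 c2
      obtain ⟨z, hz⟩ := k1 (Fin.last n)
      have hlast : q₁ (Fin.last n) + q₂ (Fin.last n) = m (Fin.last n) := congrFun hsum _
      have hx : x₁ + x₂ = (fun i : Fin n => q₁ i.castSucc) + fun i : Fin n => q₂ i.castSucc := by
        ext i
        have : q₁ i.castSucc + q₂ i.castSucc = m i.castSucc := congrFun hsum _
        simp only [Pi.add_apply]
        rw [this, hm]
      have e : x₁ - (fun i : Fin n => q₁ i.castSucc) = (fun i : Fin n => q₂ i.castSucc) - x₂ := by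
        rw [sub_eq_sub_iff_add_eq_add, hx, add_comm]
      have hz0 := hdisj _ (Submodule.sub_mem _ h₁.inC.mem_span c1.mem_span)
        (by rw [e]; exact Submodule.sub_mem _ c2.mem_span h₂.inC.mem_span)
      have e1 := sub_eq_zero.mp hz0
      rw [e] at hz0
      have e2 := sub_eq_zero.mp hz0
      rw [← e1] at c1
      rw [e2] at c2
      have b1 := (h₁ _).1 c1
      have b2 := (h₂ _).1 c2
      have hz2 : q₂ (Fin.last n) = ((m (Fin.last n) - z : ℤ) : ℝ) := by
        push_cast; linarith
      refine ⟨z, ?_, ?_⟩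
      · rw [Finset.mem_coe, Finset.mem_Icc]
        rw [hz] at b1
        rw [hz2] at b2
        have := Int.ceil_le.mpr b1
        have := Int.ceil_le.mpr b2
        omega
      · simp only [hF, Prod.mk.injEq]
        constructor
        · ext i
          refine Fin.lastCases ?_ (fun j => ?_) i
          · simpa using hz.symm
          · simpa using congrFun e1 j
        · ext i
          refine Fin.lastCases ?_ (fun j => ?_) i
          · simpa using hz2.symm
          · simpa using (congrFun e2 j).symm
    · rintro ⟨z, hz, hq⟩
      rw [Finset.mem_coe, Finset.mem_Icc] at hz
      rw [← hq]
      have b1 : g₁ ≤ (z : ℝ) := Int.ceil_le.mp hz.1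
      have b2 : g₂ ≤ ((m (Fin.last n) - z : ℤ) : ℝ) := Int.ceil_le.mp (by omega)
      refine ⟨⟨?_, isLat_snoc l₁ _⟩, ⟨?_, isLat_snoc l₂ _⟩, ?_⟩
      · rw [mem_cone_iff]
        simpa [hF] using (h₁ _).2 b1
      · rw [mem_cone_iff]
        simpa [hF] using (h₂ _).2 b2
      · ext i
        refine Fin.lastCases ?_ (fun j => ?_) i
        · simp [hF]
        · simp [hF, hm]
  unfold Npairs
  rw [hset, Set.ncard_image_of_injective _ hinj, Set.ncard_coe_finset, Int.card_Icc]

lemma npairs_zero {P Q : Set (Fin n → ℝ)} (hP : Convex ℝ P) (hQ : Convex ℝ Q)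
    (kP : IsCompact P) (kQ : IsCompact Q)
    (h0P : (0 : Fin n → ℝ) ∈ P) (h0Q : (0 : Fin n → ℝ) ∈ Q) (m : Fin (n + 1) → ℤ)
    (hno : ¬ ∃ x₁ x₂ g₁ g₂, IsLat x₁ ∧ IsLat x₂ ∧ IsG P x₁ g₁ ∧ IsG Q x₂ g₂ ∧
      ∀ i : Fin n, (m i.castSucc : ℝ) = x₁ i + x₂ i) : Npairs P Q m = 0 := by
  unfold Npairs
  refine (congrArg Set.ncard ?_).trans (Set.ncard_empty _)
  rw [Set.eq_empty_iff_forall_notMem]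
  rintro ⟨q₁, q₂⟩ ⟨⟨c1, k1⟩, ⟨c2, k2⟩, hsum⟩
  apply hno
  simp only at c1 k1 c2 k2 hsum
  rw [mem_cone_iff] at c1 c2
  obtain ⟨g₁, hg₁⟩ := exists_isG hP kP h0P c1
  obtain ⟨g₂, hg₂⟩ := exists_isG hQ kQ h0Q c2
  exact ⟨_, _, g₁, g₂, fun i => k1 _, fun i => k2 _, hg₁, hg₂, fun i => (congrFun hsum _).symm⟩

lemma exists_mul_small {a : ℝ} (h : ¬ ∃ z : ℤ, a = z) :
    ∃ k : ℕ, 0 < k ∧ ∃ z : ℤ, z < k * a ∧ k * a ≤ z + 1 / 2 := by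
  have h0 : (⌊a⌋ : ℝ) < a := lt_of_le_of_ne (Int.floor_le a) fun e => h ⟨_, e.symm⟩
  have h1 := Int.lt_floor_add_one a
  set δ := (⌊a⌋ : ℝ) + 1 - a with hδ
  have hd0 : 0 < δ := by linarith
  have hd1 : δ < 1 := by linarith
  obtain ⟨N, hN⟩ := exists_nat_gt (1 / 2 / δ)
  have hex : ∃ k : ℕ, 1 / 2 ≤ k * δ := ⟨N, by
    rw [div_lt_iff₀ hd0] at hN; linarith⟩
  have hk := Nat.find_spec hex
  have hmin := fun j => Nat.find_min hex (m := j)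
  set k := Nat.find hex
  have hkpos : 0 < k := by
    rcases Nat.eq_zero_or_pos k with e | e
    · rw [e] at hk; norm_num at hk
    · exact e
  have hlt : (k : ℝ) * δ < 1 := by
    obtain ⟨j, hj⟩ := Nat.exists_eq_succ_of_ne_zero hkpos.ne'
    have hj2 := hmin j (by omega)
    rw [hj] at hk ⊢
    push_cast at hk hj2 ⊢
    rcases Nat.eq_zero_or_pos j with e | e
    · subst e; simpa using hd1
    · have : (1 : ℝ) ≤ j := by exact_mod_cast e
      nlinarith
  refine ⟨k, hkpos, k * (⌊a⌋ + 1) - 1, ?_, ?_⟩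
  · push_cast; nlinarith
  · push_cast; nlinarith

lemma braun_iff_ceil {P Q : Set (Fin n → ℝ)} (hP : IsRatPolytope P) (hQ : IsRatPolytope Q)
    (hfree : IsFreeSum P Q) :
    (∀ m : Fin (n + 1) → ℤ,
        (Npairs P Q m : ℤ) - (Npairs P Q (m - Pi.single (Fin.last n) 1) : ℤ) =
          if (fun i => (m i : ℝ)) ∈ cone (convexHull ℝ (P ∪ Q)) then 1 else 0) ↔
      ∀ x₁ x₂ g₁ g₂, IsLat x₁ → IsLat x₂ → IsG P x₁ g₁ → IsG Q x₂ g₂ →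
        ⌈g₁ + g₂⌉ = ⌈g₁⌉ + ⌈g₂⌉ := by
  have hdisj : ∀ y, y ∈ Submodule.span ℝ P → y ∈ Submodule.span ℝ Q → y = 0 :=
    fun y h1 h2 => span_disj hP hQ hfree h1 h2
  obtain ⟨h0P, h0Q, hdec⟩ := hfree
  have cP : Convex ℝ P := by obtain ⟨V, _, rfl⟩ := hP; exact convex_convexHull ℝ _
  have cQ : Convex ℝ Q := by obtain ⟨V, _, rfl⟩ := hQ; exact convex_convexHull ℝ _
  have kP : IsCompact P := by
    obtain ⟨V, _, rfl⟩ := hP; exact V.finite_toSet.isCompact_convexHull ℝ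
  have kQ : IsCompact Q := by
    obtain ⟨V, _, rfl⟩ := hQ; exact V.finite_toSet.isCompact_convexHull ℝ
  have hcs : ∀ (m : Fin (n + 1) → ℤ) (i : Fin n),
      (m - Pi.single (Fin.last n) 1 : Fin (n + 1) → ℤ) i.castSucc = m i.castSucc := by
    intro m i
    simp [Pi.single_apply, Fin.castSucc_ne_last]
  have hlast : ∀ (m : Fin (n + 1) → ℤ),
      (m - Pi.single (Fin.last n) 1 : Fin (n + 1) → ℤ) (Fin.last n) = m (Fin.last n) - 1 := by
    intro m
    simp
  -- the equation at a decomposable point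
  have hpt : ∀ (m : Fin (n + 1) → ℤ) x₁ x₂ g₁ g₂, IsLat x₁ → IsLat x₂ → IsG P x₁ g₁ →
      IsG Q x₂ g₂ → (∀ i : Fin n, (m i.castSucc : ℝ) = x₁ i + x₂ i) →
      (((Npairs P Q m : ℤ) - (Npairs P Q (m - Pi.single (Fin.last n) 1) : ℤ) =
          if (fun i => (m i : ℝ)) ∈ cone (convexHull ℝ (P ∪ Q)) then 1 else 0) ↔
        (⌈g₁⌉ + ⌈g₂⌉ ≤ m (Fin.last n) ↔ ⌈g₁ + g₂⌉ ≤ m (Fin.last n))) := by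
    intro m x₁ x₂ g₁ g₂ l₁ l₂ h₁ h₂ hm
    rw [npairs_eq hdisj h₁ h₂ l₁ l₂ m hm, npairs_eq hdisj h₁ h₂ l₁ l₂ _
      (fun i => by rw [hcs]; exact hm i), hlast]
    have hx : (fun i : Fin n => (m i.castSucc : ℝ)) = x₁ + x₂ := by
      ext i; simp [hm]
    have hc : ((fun i => (m i : ℝ)) ∈ cone (convexHull ℝ (P ∪ Q))) ↔
        ⌈g₁ + g₂⌉ ≤ m (Fin.last n) := by
      rw [mem_cone_iff, hx, mem_cone_sum cP cQ h0P h0Q hdisj h₁ h₂, Int.ceil_le]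
    by_cases hle : ⌈g₁ + g₂⌉ ≤ m (Fin.last n)
    · rw [if_pos (hc.2 hle)]
      simp only [hle, iff_true]
      omega
    · rw [if_neg (fun h => hle (hc.1 h))]
      simp only [hle, iff_false]
      omega
  constructor
  · intro H x₁ x₂ g₁ g₂ l₁ l₂ h₁ h₂
    choose z₁ hz₁ using l₁
    choose z₂ hz₂ using l₂
    have hall : ∀ t : ℤ, (⌈g₁⌉ + ⌈g₂⌉ ≤ t ↔ ⌈g₁ + g₂⌉ ≤ t) := by
      intro t
      have := (hpt (Fin.snoc (z₁ + z₂) t : Fin (n + 1) → ℤ) x₁ x₂ g₁ g₂ (fun i => ⟨_, hz₁ i⟩)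
        (fun i => ⟨_, hz₂ i⟩) h₁ h₂ (fun i => by simp [hz₁, hz₂])).1 (H _)
      simpa using this
    exact le_antisymm ((hall _).1 le_rfl) ((hall _).2 le_rfl)
  · intro H m
    by_cases hex : ∃ x₁ x₂ g₁ g₂, IsLat x₁ ∧ IsLat x₂ ∧ IsG P x₁ g₁ ∧ IsG Q x₂ g₂ ∧
      ∀ i : Fin n, (m i.castSucc : ℝ) = x₁ i + x₂ i
    · obtain ⟨x₁, x₂, g₁, g₂, l₁, l₂, h₁, h₂, hm⟩ := hex
      rw [hpt m x₁ x₂ g₁ g₂ l₁ l₂ h₁ h₂ hm, H x₁ x₂ g₁ g₂ l₁ l₂ h₁ h₂]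
    · rw [npairs_zero cP cQ kP kQ h0P h0Q m hex, npairs_zero cP cQ kP kQ h0P h0Q _
        (by simp_rw [hcs]; exact hex), if_neg]
      · simp
      intro hmem
      apply hex
      rw [mem_cone_iff, inC_union cP cQ h0P h0Q] at hmem
      obtain ⟨y₁, t₁, y₂, t₂, a1, a2, hx, _⟩ := hmem
      obtain ⟨⟨x₁, x₂⟩, ⟨⟨s1, l1⟩, ⟨s2, l2⟩, hd⟩, -⟩ := hdec (fun i : Fin n => (m i.castSucc : ℝ))
        (by
          rw [hx]
          exact Submodule.add_mem _
            (Submodule.span_mono Set.subset_union_left a1.mem_span)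
            (Submodule.span_mono Set.subset_union_right a2.mem_span))
        (fun i => ⟨_, rfl⟩)
      simp only at s1 l1 s2 l2 hd
      have hxx : x₁ + x₂ = y₁ + y₂ := by rw [← hd, hx]
      have e : x₁ - y₁ = y₂ - x₂ := by
        rw [sub_eq_sub_iff_add_eq_add, hxx, add_comm]
      have hz : x₁ - y₁ = 0 := hdisj _ (Submodule.sub_mem _ s1 a1.mem_span)
        (by rw [e]; exact Submodule.sub_mem _ a2.mem_span s2)
      have e1 : x₁ = y₁ := sub_eq_zero.mp hz
      have e2 : y₂ = x₂ := by rw [e] at hz; exact sub_eq_zero.mp hz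
      subst e1 e2
      obtain ⟨g₁, hg₁⟩ := exists_isG cP kP h0P a1
      obtain ⟨g₂, hg₂⟩ := exists_isG cQ kQ h0Q a2
      exact ⟨_, _, g₁, g₂, l1, l2, hg₁, hg₂, fun i => congrFun hd i⟩

lemma dual_iff_int {P : Set (Fin n → ℝ)} (hP : IsRatPolytope P) (h0 : (0 : Fin n → ℝ) ∈ P) :
    DualIsLatticePolyhedron P ↔ ∀ x g, IsLat x → IsG P x g → ∃ z : ℤ, g = z := by
  obtain ⟨V, hV, rfl⟩ := hP
  exact ⟨fun h x g hx hg => isG_int_of_dual V h0 h hx hg, dual_of_isG_int V h0 hV⟩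

/-- Theorem 1.3 (characterization of the multivariate Braun equation). -/
theorem multivariate_braun_iff {n : ℕ} (hn : 1 ≤ n) (P Q : Set (Fin n → ℝ))
    (hP : IsRatPolytope P) (hQ : IsRatPolytope Q) (hfree : IsFreeSum P Q) :
    (∀ m : Fin (n + 1) → ℤ,
        (Npairs P Q m : ℤ) - (Npairs P Q (m - Pi.single (Fin.last n) 1) : ℤ) =
          if (fun i => (m i : ℝ)) ∈ cone (convexHull ℝ (P ∪ Q)) then 1 else 0) ↔
      (DualIsLatticePolyhedron P ∨ DualIsLatticePolyhedron Q) := by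
  rw [braun_iff_ceil hP hQ hfree, dual_iff_int hP hfree.1, dual_iff_int hQ hfree.2.1]
  constructor
  · intro H
    by_contra hcon
    push Not at hcon
    obtain ⟨⟨x₁, g₁, l₁, h₁, n₁⟩, x₂, g₂, l₂, h₂, n₂⟩ := hcon
    obtain ⟨k₁, hk₁, z₁, a₁, b₁⟩ := exists_mul_small (a := g₁) (by push Not; exact n₁)
    obtain ⟨k₂, hk₂, z₂, a₂, b₂⟩ := exists_mul_small (a := g₂) (by push Not; exact n₂)
    have := H _ _ _ _ (l₁.nsmul k₁) (l₂.nsmul k₂) (isG_smul (by exact_mod_cast hk₁) h₁)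
      (isG_smul (by exact_mod_cast hk₂) h₂)
    have c₁ : z₁ < ⌈(k₁ : ℝ) * g₁⌉ := Int.lt_ceil.mpr a₁
    have c₂ : z₂ < ⌈(k₂ : ℝ) * g₂⌉ := Int.lt_ceil.mpr a₂
    have c₃ : ⌈(k₁ : ℝ) * g₁ + k₂ * g₂⌉ ≤ z₁ + z₂ + 1 := by
      rw [Int.ceil_le]
      push_cast
      linarith
    omega
  · rintro (H | H) x₁ x₂ g₁ g₂ l₁ l₂ h₁ h₂
    · obtain ⟨z, rfl⟩ := H x₁ g₁ l₁ h₁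
      rw [Int.ceil_intCast_add, Int.ceil_intCast]
    · obtain ⟨z, rfl⟩ := H x₂ g₂ l₂ h₂
      rw [Int.ceil_add_intCast, Int.ceil_intCast]

end ArxivFreeSum
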